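/- For every real ρ with 1/2 < ρ < 1/√2, setting λ = √(4ρ² − 1), one has 4·∫₀^{(1−λ)/2} (1/2 − √(ρ² − (q − 1/2)²)) dq = 1 − λ − ρ²·(π − 4·arctan λ). -/

import Mathlib

open MeasureTheory Real

lemma aux_deriv (ρ q : ℝ) (h : 0 < ρ^2 - (q - 1/2)^2) :
    HasDerivAt (fun q : ℝ => q/2 - ((q - 1/2) * Real.sqrt (ρ^2 - (q - 1/2)^2)
      + ρ^2 * Real.arctan ((q - 1/2) / Real.sqrt (ρ^2 - (q - 1/2)^2)))/2)
      (1/2 - Real.sqrt (ρ^2 - (q - 1/2)^2)) q := by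
  have hx : HasDerivAt (fun q : ℝ => q - 1/2) 1 q := (hasDerivAt_id q).sub_const _
  have hs := ((hx.pow 2).const_sub (ρ^2)).sqrt h.ne'
  have hs0 : 0 < Real.sqrt (ρ^2 - (q - 1/2)^2) := Real.sqrt_pos.mpr h
  have hsq : Real.sqrt (ρ^2 - (q - 1/2)^2)^2 = ρ^2 - (q - 1/2)^2 := Real.sq_sqrt h.le
  have hF := ((hasDerivAt_id q).div_const 2).sub
    (((hx.mul hs).add (((hx.div hs hs0.ne').arctan).const_mul (ρ^2))).div_const 2)
  refine hF.congr_deriv ?_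
  simp only [Pi.pow_apply, Pi.div_apply, Nat.cast_ofNat, Nat.add_one_sub_one, pow_one, mul_one, one_mul]
  generalize Real.sqrt (ρ^2 - (q - 1/2)^2) = s at *
  generalize q - 1/2 = x at *
  have hr : ρ^2 = s^2 + x^2 := by linarith
  have hp : s^2 + x^2 ≠ 0 := by positivity
  rw [hr]
  have hs1 := hs0.ne'
  field_simp
  ring

/-- The area of the two-dimensional ball cell bounded by four circular arcs of
radius `ρ` centered at `(±1/2, ±1/2)`. -/
theorem stmt_0 (ρ : ℝ) (h1 : 1/2 < ρ) (h2 : ρ < 1/Real.sqrt 2) :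
    4 * ∫ q in (0:ℝ)..((1 - Real.sqrt (4*ρ^2 - 1))/2),
        (1/2 - Real.sqrt (ρ^2 - (q - 1/2)^2)) =
      1 - Real.sqrt (4*ρ^2 - 1)
        - ρ^2 * (Real.pi - 4 * Real.arctan (Real.sqrt (4*ρ^2 - 1))) := by
  have hpos : 0 < 4*ρ^2 - 1 := by nlinarith
  have hr2 : ρ^2 < 1/2 := by
    have h := pow_lt_pow_left₀ h2 (by linarith) (two_ne_zero)
    rwa [div_pow, Real.sq_sqrt (by norm_num), one_pow] at h
  have hl0 : 0 < Real.sqrt (4*ρ^2 - 1) := Real.sqrt_pos.mpr hpos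
  have hlsq : Real.sqrt (4*ρ^2 - 1)^2 = 4*ρ^2 - 1 := Real.sq_sqrt hpos.le
  generalize Real.sqrt (4*ρ^2 - 1) = l at *
  have hl1 : l < 1 := by nlinarith
  rw [intervalIntegral.integral_eq_sub_of_hasDerivAt (fun q hq => aux_deriv ρ q ?_)
    (Continuous.intervalIntegrable (by fun_prop) _ _)]
  · have e1 : Real.sqrt (ρ^2 - ((1 - l)/2 - 1/2)^2) = 1/2 := by
      rw [show ρ^2 - ((1 - l)/2 - 1/2)^2 = (1/2)^2 by nlinarith]
      exact Real.sqrt_sq (by norm_num)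
    have e2 : Real.sqrt (ρ^2 - (0 - 1/2)^2) = l/2 := by
      rw [show ρ^2 - (0 - 1/2)^2 = (l/2)^2 by nlinarith]
      exact Real.sqrt_sq (by linarith)
    have e3 : ((1 - l)/2 - 1/2) / (1/2) = -l := by ring
    have e4 : ((0:ℝ) - 1/2) / (l/2) = -l⁻¹ := by field_simp; ring
    simp only [e1, e2, e3, e4, Real.arctan_neg, Real.arctan_inv_of_pos hl0]
    ring
  · rw [Set.uIcc_of_le (by linarith)] at hq
    nlinarith [hq.1, hq.2]
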